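/- arXiv:1103.1745 — 6 statements merged into one kernel-verified Lean document; each statement's English description precedes it below -/
import Mathlib

section
/- Let B = (A, R) be a blueprint with unique inverses, i.e. for every a ∈ A there is exactly one b ∈ A with a + b ≡ 0. Then B is proper: a ≡ b with a, b ∈ A implies a = b in A. -/
/-! A blueprint `B = (A, R)` is a commutative monoid `A` together with a pre-addition `R`,
i.e. a semiring congruence (`RingCon`) on the monoid semiring `ℕ[A] = MonoidAlgebra ℕ A`.
Elements `a ∈ A` are identified with their images under `MonoidAlgebra.of ℕ A`.
`B` is *proper* if `a ≡ b` with `a, b ∈ A` implies `a = b` in `A`. -/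

/-- If `B = (A, R)` has unique inverses (for every `a ∈ A` there is exactly one
`b ∈ A` with `a + b ≡ 0`), then `B` is proper. -/
theorem blueprint_uniqueInverses_proper {A : Type*} [CommMonoid A]
    (R : RingCon (MonoidAlgebra ℕ A))
    (huniq : ∀ a : A, ∃! b : A, R (MonoidAlgebra.of ℕ A a + MonoidAlgebra.of ℕ A b) 0) :
    ∀ a b : A, R (MonoidAlgebra.of ℕ A a) (MonoidAlgebra.of ℕ A b) → a = b := by
  intro a b hab
  obtain ⟨c, hac, -⟩ := huniq a
  have hbc := R.trans (R.add (R.symm hab) (R.refl (MonoidAlgebra.of ℕ A c))) hac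
  rw [add_comm] at hac hbc
  exact (huniq c).unique hac hbc
end

section
/- Let B = (A, R) be a blueprint. Then there exists a proper blueprint B_prop = (A_prop, R_prop) and a morphism π : B → B_prop of blueprints such that for every proper blueprint C and every morphism f : B → C of blueprints there is a unique morphism f_prop : B_prop → C with f = f_prop ∘ π. Moreover, if B is cancellative, with inverses, or with a zero, then B_prop is also cancellative, with inverses, resp. with a zero. -/
/-! A blueprint `B = (A, R)` is a commutative monoid `A` together with a pre-addition `R`,
i.e. a semiring congruence (`RingCon`) on the monoid semiring `ℕ[A] = MonoidAlgebra ℕ A`.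
Elements `a ∈ A` are identified with their images under `MonoidAlgebra.of ℕ A`. -/

universe u v

/-- A bundled blueprint. -/
structure Blueprint : Type (u + 1) where
  carrier : Type u
  [mon : CommMonoid carrier]
  R : RingCon (MonoidAlgebra ℕ carrier)

attribute [instance] Blueprint.mon

/-- A morphism of blueprints: a monoid homomorphism of the underlying monoids whose
ℕ-linear extension to the monoid semirings maps related elements to related elements. -/
structure BlueprintHom {A B : Type*} [CommMonoid A] [CommMonoid B]
    (R : RingCon (MonoidAlgebra ℕ A)) (S : RingCon (MonoidAlgebra ℕ B)) where
  toMonoidHom : A →* B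
  map_rel : ∀ x y : MonoidAlgebra ℕ A, R x y →
    S (MonoidAlgebra.mapDomainRingHom ℕ toMonoidHom x)
      (MonoidAlgebra.mapDomainRingHom ℕ toMonoidHom y)

/-- `B` is *proper*. -/
def Blueprint.IsProper {A : Type*} [CommMonoid A] (R : RingCon (MonoidAlgebra ℕ A)) : Prop :=
  ∀ a b : A, R (MonoidAlgebra.of ℕ A a) (MonoidAlgebra.of ℕ A b) → a = b

/-- `B` is *cancellative*. -/
def Blueprint.Cancellative {A : Type*} [CommMonoid A] (R : RingCon (MonoidAlgebra ℕ A)) : Prop :=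
  ∀ x y z : MonoidAlgebra ℕ A, R (x + z) (y + z) → R x y

/-- `B` is *with inverses*. -/
def Blueprint.WithInverses {A : Type*} [CommMonoid A] (R : RingCon (MonoidAlgebra ℕ A)) : Prop :=
  ∀ a : A, ∃ b : A, R (MonoidAlgebra.of ℕ A a + MonoidAlgebra.of ℕ A b) 0

/-- `B` is *with a zero*. -/
def Blueprint.HasZeroElem {A : Type*} [CommMonoid A] (R : RingCon (MonoidAlgebra ℕ A)) : Prop :=
  ∃ e : A, R (MonoidAlgebra.of ℕ A e) 0

namespace Blueprint

variable {A : Type*} [CommMonoid A]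

lemma mapDomainRingHom_of {B : Type*} [CommMonoid B] (f : A →* B) (a : A) :
    MonoidAlgebra.mapDomainRingHom ℕ f (MonoidAlgebra.of ℕ A a) = MonoidAlgebra.of ℕ B (f a) := by
  simp

lemma mapDomainRingHom_surjective {B : Type*} [CommMonoid B] {f : A →* B}
    (hf : Function.Surjective f) :
    Function.Surjective (MonoidAlgebra.mapDomainRingHom ℕ f) := by
  intro x
  induction x using MonoidAlgebra.induction_on with
  | of b =>
    obtain ⟨a, rfl⟩ := hf b
    exact ⟨MonoidAlgebra.of ℕ A a, mapDomainRingHom_of f a⟩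
  | add x y hx hy =>
    obtain ⟨x, rfl⟩ := hx
    obtain ⟨y, rfl⟩ := hy
    exact ⟨x + y, map_add _ x y⟩
  | smul n x hx =>
    obtain ⟨x, rfl⟩ := hx
    exact ⟨n • x, map_nsmul _ n x⟩

/-- The congruence on `A` identifying `a` and `b` whenever they are related by `R`. -/
noncomputable def properCon (R : RingCon (MonoidAlgebra ℕ A)) : Con A :=
  R.toCon.comap (MonoidAlgebra.of ℕ A) (map_mul _)

lemma properCon_apply {R : RingCon (MonoidAlgebra ℕ A)} {a b : A} :
    properCon R a b ↔ R (MonoidAlgebra.of ℕ A a) (MonoidAlgebra.of ℕ A b) :=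
  Iff.rfl

/-- The semiring homomorphism from `ℕ[A_prop]` to the quotient of `ℕ[A]` by `R`. -/
noncomputable def properEval (R : RingCon (MonoidAlgebra ℕ A)) :
    MonoidAlgebra ℕ (properCon R).Quotient →+* R.Quotient :=
  (MonoidAlgebra.lift ℕ R.Quotient (properCon R).Quotient
    ((properCon R).lift ((R.mk' : MonoidAlgebra ℕ A →* R.Quotient).comp (MonoidAlgebra.of ℕ A))
      fun _ _ h => Con.ker_apply.2 (R.eq.2 h))).toRingHom

lemma properEval_mapDomainRingHom (R : RingCon (MonoidAlgebra ℕ A)) (x : MonoidAlgebra ℕ A) :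
    properEval R (MonoidAlgebra.mapDomainRingHom ℕ (properCon R).mk' x) = R.mk' x := by
  induction x using MonoidAlgebra.induction_on with
  | of a =>
    rw [mapDomainRingHom_of]
    exact MonoidAlgebra.lift_of _ _
  | add x y hx hy => simp only [map_add, hx, hy]
  | smul n x hx => simp only [map_nsmul, hx]

/-- The pre-addition of the properification. -/
noncomputable def properRel (R : RingCon (MonoidAlgebra ℕ A)) :
    RingCon (MonoidAlgebra ℕ (properCon R).Quotient) :=
  RingCon.ker (properEval R)

lemma properRel_mapDomainRingHom {R : RingCon (MonoidAlgebra ℕ A)} {x y : MonoidAlgebra ℕ A} :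
    properRel R (MonoidAlgebra.mapDomainRingHom ℕ (properCon R).mk' x)
      (MonoidAlgebra.mapDomainRingHom ℕ (properCon R).mk' y) ↔ R x y := by
  rw [properRel, RingCon.ker_apply, properEval_mapDomainRingHom, properEval_mapDomainRingHom]
  exact R.eq

lemma isProper_properRel (R : RingCon (MonoidAlgebra ℕ A)) : IsProper (properRel R) := by
  intro a b h
  obtain ⟨a, rfl⟩ := (properCon R).mk'_surjective a
  obtain ⟨b, rfl⟩ := (properCon R).mk'_surjective b
  rw [← mapDomainRingHom_of, ← mapDomainRingHom_of, properRel_mapDomainRingHom] at h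
  exact (properCon R).eq.2 h

/-- The canonical morphism from a blueprint to its properification. -/
noncomputable def toProper (R : RingCon (MonoidAlgebra ℕ A)) : BlueprintHom R (properRel R) where
  toMonoidHom := (properCon R).mk'
  map_rel _ _ h := properRel_mapDomainRingHom.2 h

/-- The morphism from the properification induced by a morphism to a proper blueprint. -/
noncomputable def properLift {R : RingCon (MonoidAlgebra ℕ A)} {C : Type*} [CommMonoid C]
    {S : RingCon (MonoidAlgebra ℕ C)} (hS : IsProper S) (f : BlueprintHom R S) :
    BlueprintHom (properRel R) S where
  toMonoidHom := (properCon R).lift f.toMonoidHom fun a b h => hS _ _ <| by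
    simpa only [mapDomainRingHom_of] using f.map_rel _ _ (properCon_apply.1 h)
  map_rel x y h := by
    obtain ⟨x, rfl⟩ := mapDomainRingHom_surjective (properCon R).mk'_surjective x
    obtain ⟨y, rfl⟩ := mapDomainRingHom_surjective (properCon R).mk'_surjective y
    rw [← RingHom.comp_apply, ← RingHom.comp_apply, ← MonoidAlgebra.mapDomainRingHom_comp]
    exact f.map_rel x y (properRel_mapDomainRingHom.1 h)

lemma Cancellative.properRel {R : RingCon (MonoidAlgebra ℕ A)} (hR : Cancellative R) :
    Cancellative (properRel R) := by
  intro x y z h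
  obtain ⟨x, rfl⟩ := mapDomainRingHom_surjective (properCon R).mk'_surjective x
  obtain ⟨y, rfl⟩ := mapDomainRingHom_surjective (properCon R).mk'_surjective y
  obtain ⟨z, rfl⟩ := mapDomainRingHom_surjective (properCon R).mk'_surjective z
  rw [← map_add, ← map_add, properRel_mapDomainRingHom] at h
  exact properRel_mapDomainRingHom.2 (hR x y z h)

lemma WithInverses.properRel {R : RingCon (MonoidAlgebra ℕ A)} (hR : WithInverses R) :
    WithInverses (properRel R) := by
  intro a
  obtain ⟨a, rfl⟩ := (properCon R).mk'_surjective a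
  obtain ⟨b, hb⟩ := hR a
  refine ⟨(properCon R).mk' b, ?_⟩
  rw [← mapDomainRingHom_of, ← mapDomainRingHom_of, ← map_add,
    ← map_zero (MonoidAlgebra.mapDomainRingHom ℕ (properCon R).mk')]
  exact properRel_mapDomainRingHom.2 hb

lemma HasZeroElem.properRel {R : RingCon (MonoidAlgebra ℕ A)} (hR : HasZeroElem R) :
    HasZeroElem (properRel R) := by
  obtain ⟨e, he⟩ := hR
  refine ⟨(properCon R).mk' e, ?_⟩
  rw [← mapDomainRingHom_of, ← map_zero (MonoidAlgebra.mapDomainRingHom ℕ (properCon R).mk')]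
  exact properRel_mapDomainRingHom.2 he

end Blueprint

/-- For every blueprint `B` there is a proper blueprint `B_prop` together with a
morphism `π : B → B_prop` such that every morphism from `B` into a proper blueprint `C`
factors uniquely through `π`. Moreover, if `B` is cancellative, with inverses or with a zero,
then `B_prop` is so too. -/
theorem blueprint_exists_properification {A : Type u} [CommMonoid A]
    (R : RingCon (MonoidAlgebra ℕ A)) :
    ∃ (Bp : Blueprint.{u}) (π : BlueprintHom R Bp.R),
      Blueprint.IsProper Bp.R ∧
      (∀ (C : Blueprint.{v}), Blueprint.IsProper C.R → ∀ f : BlueprintHom R C.R,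
        ∃! g : BlueprintHom Bp.R C.R,
          ∀ a : A, g.toMonoidHom (π.toMonoidHom a) = f.toMonoidHom a) ∧
      (Blueprint.Cancellative R → Blueprint.Cancellative Bp.R) ∧
      (Blueprint.WithInverses R → Blueprint.WithInverses Bp.R) ∧
      (Blueprint.HasZeroElem R → Blueprint.HasZeroElem Bp.R) := by
  refine ⟨⟨(Blueprint.properCon R).Quotient, Blueprint.properRel R⟩, Blueprint.toProper R,
    Blueprint.isProper_properRel R, fun C hC f => ⟨Blueprint.properLift hC f, fun _ => rfl, ?_⟩,
    Blueprint.Cancellative.properRel, Blueprint.WithInverses.properRel,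
    Blueprint.HasZeroElem.properRel⟩
  rintro ⟨g, hg⟩ h
  congr 1
  ext a
  exact h a
end

section
/- Let B = (A, R) be a blueprint. Then there exists a proper blueprint B_inv with inverses and a morphism π : B → B_inv of blueprints such that every morphism from B into a proper blueprint with inverses factors uniquely through π. -/
/-! A blueprint `B = (A, R)` is a commutative monoid `A` together with a pre-addition `R`,
i.e. a semiring congruence (`RingCon`) on the monoid semiring `ℕ[A] = MonoidAlgebra ℕ A`.
Elements `a ∈ A` are identified with their images under `MonoidAlgebra.of ℕ A`. -/

universe u v

namespace Blueprint

/-- Ring homomorphisms out of `ℕ[A]` are determined by their values on `A`. -/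
lemma ringHom_ext_of {A S : Type*} [CommMonoid A] [Semiring S]
    {f g : MonoidAlgebra ℕ A →+* S}
    (h : ∀ a, f (MonoidAlgebra.of ℕ A a) = g (MonoidAlgebra.of ℕ A a)) : f = g :=
  MonoidAlgebra.ringHom_ext' (Subsingleton.elim _ _) (MonoidHom.ext h)

/-- The `ℕ`-linear extension of a monoid homomorphism into a commutative semiring. -/
noncomputable def eval {A S : Type*} [CommMonoid A] [CommSemiring S] (j : A →* S) :
    MonoidAlgebra ℕ A →+* S :=
  (MonoidAlgebra.lift ℕ S A j).toRingHom

@[simp]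
lemma eval_of {A S : Type*} [CommMonoid A] [CommSemiring S] (j : A →* S) (a : A) :
    eval j (MonoidAlgebra.of ℕ A a) = j a :=
  MonoidAlgebra.lift_of j a

lemma eval_mapDomainRingHom {A B S : Type*} [CommMonoid A] [CommMonoid B] [CommSemiring S]
    (j : B →* S) (f : A →* B) (x : MonoidAlgebra ℕ A) :
    eval j (MonoidAlgebra.mapDomainRingHom ℕ f x) = eval (j.comp f) x := by
  have h : (eval j).comp (MonoidAlgebra.mapDomainRingHom ℕ f) = eval (j.comp f) := by
    apply ringHom_ext_of
    intro a
    have hm : MonoidAlgebra.mapDomainRingHom ℕ f (MonoidAlgebra.of ℕ A a) =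
        MonoidAlgebra.of ℕ B (f a) := by simp
    rw [RingHom.comp_apply, hm, eval_of, eval_of, MonoidHom.comp_apply]
  exact RingHom.congr_fun h x

lemma map_eval {A S T : Type*} [CommMonoid A] [CommSemiring S] [CommSemiring T]
    (φ : S →+* T) (j : A →* S) (x : MonoidAlgebra ℕ A) :
    φ (eval j x) = eval ((φ : S →* T).comp j) x := by
  have h : φ.comp (eval j) = eval ((φ : S →* T).comp j) := by
    apply ringHom_ext_of
    intro a
    rw [RingHom.comp_apply, eval_of, eval_of]
    rfl
  exact RingHom.congr_fun h x

/-- The elements `± ι a` of a commutative ring, as a submonoid. -/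
def signedRange {A Q : Type*} [CommMonoid A] [CommRing Q] (ι : A →* Q) : Submonoid Q where
  carrier := {q | ∃ a, q = ι a ∨ q = -ι a}
  one_mem' := ⟨1, Or.inl ι.map_one.symm⟩
  mul_mem' := by
    rintro _ _ ⟨a, rfl | rfl⟩ ⟨b, rfl | rfl⟩ <;> refine ⟨a * b, ?_⟩ <;> simp

lemma exists_signedRange_lift {A C Q T : Type*} [CommMonoid A] [CommMonoid C] [CommRing Q]
    [CommRing T] (ι : A →* Q) (j : C →* T) (hj : Function.Injective j)
    (hneg : ∀ c, ∃ d, j c + j d = 0) (φ : Q →+* T) (f : A →* C)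
    (h : ∀ a, φ (ι a) = j (f a)) :
    ∃ g : signedRange ι →* C, ∀ q, j (g q) = φ q := by
  have key : ∀ q : signedRange ι, ∃ c, j c = φ q := by
    rintro ⟨_, a, rfl | rfl⟩
    · exact ⟨f a, (h a).symm⟩
    · obtain ⟨d, hd⟩ := hneg (f a)
      refine ⟨d, ?_⟩
      rw [map_neg, h]
      exact eq_neg_of_add_eq_zero_right hd
  choose g hg using key
  refine ⟨⟨⟨g, hj ?_⟩, fun p q => hj ?_⟩, hg⟩
  · rw [hg]; simp
  · simp [hg]

/-- A commutative semiring whose elements have additive inverses is a commutative ring. -/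
noncomputable abbrev commRingOfExistsNeg (S : Type*) [inst : CommSemiring S]
    (h : ∀ x : S, ∃ y, x + y = 0) : CommRing S :=
  letI : Neg S := ⟨fun x => (h x).choose⟩
  { inst with
    zsmul := zsmulRec
    neg_add_cancel := fun x => (add_comm _ x).trans (h x).choose_spec }

/-- If all `a ∈ A` have additive inverses modulo `R`, so do all elements of `ℕ[A] / R`. -/
lemma WithInverses.exists_add_eq_zero {A : Type*} [CommMonoid A]
    {R : RingCon (MonoidAlgebra ℕ A)} (h : WithInverses R) (x : R.Quotient) :
    ∃ y, x + y = 0 := by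
  obtain ⟨x, rfl⟩ := R.mk'_surjective x
  induction x using MonoidAlgebra.induction_on with
  | of a =>
    obtain ⟨b, hb⟩ := h a
    exact ⟨R.mk' (MonoidAlgebra.of ℕ A b), R.eq.2 hb⟩
  | add x y hx hy =>
    obtain ⟨x', hx⟩ := hx
    obtain ⟨y', hy⟩ := hy
    refine ⟨x' + y', ?_⟩
    rw [map_add, add_add_add_comm, hx, hy, add_zero]
  | smul n x hx =>
    obtain ⟨x', hx⟩ := hx
    refine ⟨n • x', ?_⟩
    rw [map_nsmul, ← nsmul_add, hx, nsmul_zero]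

/-- The ideal of `ℤ[A]` generated by the differences of `R`-related elements. -/
noncomputable def relIdeal {A : Type*} [CommMonoid A] (R : RingCon (MonoidAlgebra ℕ A)) :
    Ideal (MonoidAlgebra ℤ A) :=
  Ideal.span {z | ∃ x y, R x y ∧
    z = eval (MonoidAlgebra.of ℤ A) x - eval (MonoidAlgebra.of ℤ A) y}

/-- The canonical map from `A` to the ring completion `ℤ[A] / relIdeal R` of `ℕ[A] / R`. -/
noncomputable def toRing {A : Type*} [CommMonoid A] (R : RingCon (MonoidAlgebra ℕ A)) :
    A →* MonoidAlgebra ℤ A ⧸ relIdeal R :=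
  ((Ideal.Quotient.mk (relIdeal R) : _ →+* _) : _ →* _).comp (MonoidAlgebra.of ℤ A)

lemma eval_toRing_eq {A : Type*} [CommMonoid A] {R : RingCon (MonoidAlgebra ℕ A)}
    {x y : MonoidAlgebra ℕ A} (h : R x y) : eval (toRing R) x = eval (toRing R) y := by
  rw [toRing, ← map_eval, ← map_eval, Ideal.Quotient.eq]
  exact Ideal.subset_span ⟨x, y, h, rfl⟩

lemma exists_ringHom_toRing {A T : Type*} [CommMonoid A] [CommRing T]
    {R : RingCon (MonoidAlgebra ℕ A)} (j : A →* T)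
    (h : ∀ x y, R x y → eval j x = eval j y) :
    ∃ φ : MonoidAlgebra ℤ A ⧸ relIdeal R →+* T, ∀ a, φ (toRing R a) = j a := by
  let ψ : MonoidAlgebra ℤ A →+* T := (MonoidAlgebra.lift ℤ T A j).toRingHom
  have hψ : (ψ : MonoidAlgebra ℤ A →* T).comp (MonoidAlgebra.of ℤ A) = j :=
    MonoidHom.ext fun a => MonoidAlgebra.lift_of j a
  have hI : relIdeal R ≤ RingHom.ker ψ := by
    rw [relIdeal, Ideal.span_le]
    rintro _ ⟨x, y, hxy, rfl⟩
    rw [SetLike.mem_coe, RingHom.mem_ker, map_sub, map_eval, map_eval, hψ, h x y hxy, sub_self]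
  exact ⟨Ideal.Quotient.lift _ ψ hI, fun a => DFunLike.congr_fun hψ a⟩

lemma eval_mk' {A : Type*} [CommMonoid A] (R : RingCon (MonoidAlgebra ℕ A)) :
    eval (S := R.Quotient)
      ((R.mk' : MonoidAlgebra ℕ A →* R.Quotient).comp (MonoidAlgebra.of ℕ A)) = R.mk' :=
  ringHom_ext_of fun a => eval_of _ a

/-- A proper blueprint with inverses embeds into a commutative ring inducing its pre-addition. -/
lemma exists_ring_embedding {C : Type v} [CommMonoid C] {S : RingCon (MonoidAlgebra ℕ C)}
    (hp : IsProper S) (hi : WithInverses S) :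
    ∃ (T : Type v) (_ : CommRing T) (j : C →* T), Function.Injective j ∧
      (∀ c, ∃ d, j c + j d = 0) ∧ ∀ x y, S x y ↔ eval j x = eval j y := by
  refine ⟨S.Quotient, commRingOfExistsNeg _ hi.exists_add_eq_zero,
    (S.mk' : MonoidAlgebra ℕ C →* S.Quotient).comp (MonoidAlgebra.of ℕ C), ?_, ?_, ?_⟩
  · intro a b hab
    exact hp a b (S.eq.1 hab)
  · intro c
    obtain ⟨d, hd⟩ := hi c
    exact ⟨d, S.eq.2 hd⟩
  · intro x y
    have h := RingHom.congr_fun (eval_mk' S)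
    exact S.eq.symm.trans (Eq.congr (h x) (h y)).symm

end Blueprint

/-- For every blueprint `B` there is a proper blueprint `B_inv` with inverses
together with a morphism `π : B → B_inv` such that every morphism from `B` into a proper
blueprint with inverses factors uniquely through `π`. -/
theorem blueprint_exists_inv_completion {A : Type u} [CommMonoid A]
    (R : RingCon (MonoidAlgebra ℕ A)) :
    ∃ (Bi : Blueprint.{u}) (π : BlueprintHom R Bi.R),
      Blueprint.IsProper Bi.R ∧ Blueprint.WithInverses Bi.R ∧
      ∀ (C : Blueprint.{v}), Blueprint.IsProper C.R → Blueprint.WithInverses C.R →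
        ∀ f : BlueprintHom R C.R,
          ∃! g : BlueprintHom Bi.R C.R,
            ∀ a : A, g.toMonoidHom (π.toMonoidHom a) = f.toMonoidHom a := by
  let ι := Blueprint.toRing R
  let s : Blueprint.signedRange ι →* MonoidAlgebra ℤ A ⧸ Blueprint.relIdeal R :=
    (Blueprint.signedRange ι).subtype
  let p : A →* Blueprint.signedRange ι := ι.codRestrict _ fun a => ⟨a, Or.inl rfl⟩
  have hsp : s.comp p = ι := rfl
  let Ri : RingCon (MonoidAlgebra ℕ (Blueprint.signedRange ι)) := RingCon.ker (Blueprint.eval s)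
  have hRi : ∀ x y, Ri x y ↔ Blueprint.eval s x = Blueprint.eval s y := fun x y => Iff.rfl
  have neg_rel : ∀ q q' : Blueprint.signedRange ι, (q : _ ⧸ Blueprint.relIdeal R) + q' = 0 →
      Ri (MonoidAlgebra.of ℕ _ q + MonoidAlgebra.of ℕ _ q') 0 := fun q q' h => by
    rw [hRi, map_add, map_zero, Blueprint.eval_of, Blueprint.eval_of]
    exact h
  refine ⟨⟨Blueprint.signedRange ι, Ri⟩, ⟨p, fun x y h => ?_⟩, fun a b h => ?_, ?_, ?_⟩
  · rw [hRi, Blueprint.eval_mapDomainRingHom, Blueprint.eval_mapDomainRingHom, hsp]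
    exact Blueprint.eval_toRing_eq h
  · rw [hRi, Blueprint.eval_of, Blueprint.eval_of] at h
    exact Subtype.ext h
  · rintro ⟨_, a, rfl | rfl⟩
    · exact ⟨⟨-ι a, a, Or.inr rfl⟩, neg_rel _ _ (add_neg_cancel _)⟩
    · exact ⟨⟨ι a, a, Or.inl rfl⟩, neg_rel _ _ (neg_add_cancel _)⟩
  · intro C hp hi f
    obtain ⟨T, _, j, hj, hneg, hS⟩ := Blueprint.exists_ring_embedding hp hi
    obtain ⟨φ, hφ⟩ := Blueprint.exists_ringHom_toRing (R := R) (j.comp f.toMonoidHom)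
      fun x y h => by
        rw [← Blueprint.eval_mapDomainRingHom, ← Blueprint.eval_mapDomainRingHom, ← hS]
        exact f.map_rel x y h
    obtain ⟨g, hg⟩ := Blueprint.exists_signedRange_lift ι j hj hneg φ f.toMonoidHom hφ
    have hgs : j.comp g = (φ : _ →* T).comp s := MonoidHom.ext hg
    refine ⟨⟨g, fun x y h => ?_⟩, fun a => hj ((hg (p a)).trans (hφ a)), ?_⟩
    · rw [hS, Blueprint.eval_mapDomainRingHom, Blueprint.eval_mapDomainRingHom, hgs,
        ← Blueprint.map_eval, ← Blueprint.map_eval, (hRi x y).1 h]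
    · rintro ⟨g', hg'⟩ hfac
      have hpos : ∀ a, j (g' (p a)) = φ (ι a) := fun a => by
        rw [hφ]; exact congrArg j (hfac a)
      have hall : ∀ q, g' q = g q := by
        rintro ⟨_, a, rfl | rfl⟩ <;> refine hj (Eq.trans ?_ (hg _).symm)
        · exact hpos a
        · have h := hg' _ _ (neg_rel (p a) ⟨-ι a, a, Or.inr rfl⟩ (add_neg_cancel _))
          rw [hS, Blueprint.eval_mapDomainRingHom, map_add, map_zero, map_zero,
            Blueprint.eval_of, Blueprint.eval_of, MonoidHom.comp_apply, MonoidHom.comp_apply,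
            hpos] at h
          rw [map_neg]
          exact eq_neg_of_add_eq_zero_right h
      obtain rfl : g' = g := MonoidHom.ext hall
      rfl
end

section
/- Let B = (A, R) be a blueprint. Then there exists a proper blueprint B₀ with a zero and a morphism π : B → B₀ of blueprints such that every morphism from B into a proper blueprint with a zero factors uniquely through π. -/
/-! A blueprint `B = (A, R)` is a commutative monoid `A` together with a pre-addition `R`,
i.e. a semiring congruence (`RingCon`) on the monoid semiring `ℕ[A] = MonoidAlgebra ℕ A`.
Elements `a ∈ A` are identified with their images under `MonoidAlgebra.of ℕ A`. -/

universe u v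

namespace Blueprint

section

variable {A : Type*} [CommMonoid A] (R : RingCon (MonoidAlgebra ℕ A))

/-- The universal semiring `ℕ[A] / R` of a blueprint. -/
def UniversalSemiring : Type _ := R.Quotient

noncomputable instance : CommSemiring (UniversalSemiring R) :=
  inferInstanceAs (CommSemiring R.Quotient)

/-- The quotient homomorphism onto the universal semiring. -/
noncomputable def mkQuotient : MonoidAlgebra ℕ A →+* UniversalSemiring R := R.mk'

theorem mkQuotient_eq_iff {x y : MonoidAlgebra ℕ A} :
    mkQuotient R x = mkQuotient R y ↔ R x y :=
  R.eq

/-- The canonical map from the monoid of a blueprint to its universal semiring. -/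
noncomputable def toQuotient : A →* UniversalSemiring R :=
  (mkQuotient R : MonoidAlgebra ℕ A →* UniversalSemiring R).comp (MonoidAlgebra.of ℕ A)

theorem toQuotient_apply (a : A) : toQuotient R a = mkQuotient R (MonoidAlgebra.of ℕ A a) := rfl

theorem toQuotient_injective {R : RingCon (MonoidAlgebra ℕ A)} (h : IsProper R) :
    Function.Injective (toQuotient R) :=
  fun a b hab ↦ h a b ((mkQuotient_eq_iff R).1 hab)

/-- The image of the monoid of a blueprint in its universal semiring, with zero adjoined. -/
def zeroCompletion : Submonoid (UniversalSemiring R) where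
  carrier := {q | q = 0 ∨ ∃ a, toQuotient R a = q}
  one_mem' := Or.inr ⟨1, map_one _⟩
  mul_mem' := by
    rintro _ _ (rfl | ⟨a, rfl⟩) (rfl | ⟨b, rfl⟩)
    · exact Or.inl (zero_mul _)
    · exact Or.inl (zero_mul _)
    · exact Or.inl (mul_zero _)
    · exact Or.inr ⟨a * b, map_mul _ _ _⟩

end

section

variable {Q : Type*} [CommSemiring Q]

/-- The semiring homomorphism `ℕ[M] → Q` induced by the inclusion of a submonoid `M` of `Q`. -/
noncomputable def evalSubmonoid (M : Submonoid Q) : MonoidAlgebra ℕ M →+* Q :=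
  (MonoidAlgebra.lift ℕ Q M M.subtype).toRingHom

theorem evalSubmonoid_of (M : Submonoid Q) (m : M) :
    evalSubmonoid M (MonoidAlgebra.of ℕ M m) = m := by
  simp [evalSubmonoid]

/-- The pre-addition on a submonoid of a semiring inherited from the addition of the semiring. -/
noncomputable def submonoidRel (M : Submonoid Q) : RingCon (MonoidAlgebra ℕ M) :=
  RingCon.ker (evalSubmonoid M)

theorem submonoidRel_iff (M : Submonoid Q) {x y : MonoidAlgebra ℕ M} :
    submonoidRel M x y ↔ evalSubmonoid M x = evalSubmonoid M y :=
  Iff.rfl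

theorem isProper_submonoidRel (M : Submonoid Q) : IsProper (submonoidRel M) := by
  intro a b h
  rw [submonoidRel_iff, evalSubmonoid_of, evalSubmonoid_of] at h
  exact Subtype.ext h

end

end Blueprint

namespace BlueprintHom

open Blueprint

variable {A B : Type*} [CommMonoid A] [CommMonoid B]
  {R : RingCon (MonoidAlgebra ℕ A)} {S : RingCon (MonoidAlgebra ℕ B)}

theorem toMonoidHom_injective :
    Function.Injective (toMonoidHom : BlueprintHom R S → A →* B) := by
  rintro ⟨f, _⟩ ⟨g, _⟩ rfl
  rfl

/-- The homomorphism of universal semirings induced by a morphism of blueprints. -/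
noncomputable def quotientMap (f : BlueprintHom R S) :
    UniversalSemiring R →+* UniversalSemiring S :=
  R.lift ((mkQuotient S).comp (MonoidAlgebra.mapDomainRingHom ℕ f.toMonoidHom))
    fun x y h ↦ (mkQuotient_eq_iff S).2 (f.map_rel x y h)

theorem quotientMap_toQuotient (f : BlueprintHom R S) (a : A) :
    f.quotientMap (toQuotient R a) = toQuotient S (f.toMonoidHom a) := by
  change mkQuotient S
    (MonoidAlgebra.mapDomainRingHom ℕ f.toMonoidHom (MonoidAlgebra.of ℕ A a)) = _
  simp [toQuotient_apply]

theorem toMonoidHom_eq_of_rel_zero (f : BlueprintHom R S) (hS : IsProper S) {a : A} {e : B}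
    (ha : R (MonoidAlgebra.of ℕ A a) 0) (he : S (MonoidAlgebra.of ℕ B e) 0) :
    f.toMonoidHom a = e := by
  refine hS _ _ (S.trans ?_ (S.symm he))
  simpa using f.map_rel _ _ ha

variable (R) in
/-- The canonical morphism from a blueprint to its zero completion. -/
noncomputable def toZeroCompletion : BlueprintHom R (submonoidRel (zeroCompletion R)) where
  toMonoidHom := (toQuotient R).codRestrict (zeroCompletion R) fun a ↦ Or.inr ⟨a, rfl⟩
  map_rel x y h := by
    have key : (evalSubmonoid (zeroCompletion R)).comp (MonoidAlgebra.mapDomainRingHom ℕ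
        ((toQuotient R).codRestrict (zeroCompletion R) fun a ↦ Or.inr ⟨a, rfl⟩)) =
        mkQuotient R := by
      refine MonoidAlgebra.ringHom_ext' (Subsingleton.elim _ _) (MonoidHom.ext fun a ↦ ?_)
      have h_of : evalSubmonoid (zeroCompletion R)
          (MonoidAlgebra.of ℕ _ ((toQuotient R).codRestrict _ (fun a ↦ Or.inr ⟨a, rfl⟩) a)) =
          mkQuotient R (MonoidAlgebra.of ℕ A a) := evalSubmonoid_of _ _
      simpa using h_of
    have hx := RingHom.congr_fun key x
    have hy := RingHom.congr_fun key y
    rw [RingHom.comp_apply] at hx hy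
    rw [submonoidRel_iff, hx, hy]
    exact (mkQuotient_eq_iff R).2 h

/-- A monoid homomorphism out of a submonoid `M` of a semiring which is compatible with a
homomorphism into the universal semiring of the target is a morphism of blueprints. -/
def ofSubmonoid {Q : Type*} [CommSemiring Q] {M : Submonoid Q} (φ : Q →+* UniversalSemiring S)
    (g : M →* B) (hg : ∀ m : M, toQuotient S (g m) = φ m) :
    BlueprintHom (submonoidRel M) S where
  toMonoidHom := g
  map_rel x y h := by
    have key : (mkQuotient S).comp (MonoidAlgebra.mapDomainRingHom ℕ g) =
        φ.comp (evalSubmonoid M) := by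
      refine MonoidAlgebra.ringHom_ext' (Subsingleton.elim _ _) (MonoidHom.ext fun m ↦ ?_)
      have := evalSubmonoid_of M m
      simp_all [toQuotient_apply]
    rw [submonoidRel_iff] at h
    have hx := RingHom.congr_fun key x
    have hy := RingHom.congr_fun key y
    rw [RingHom.comp_apply, RingHom.comp_apply] at hx hy
    rw [← mkQuotient_eq_iff, hx, hy, h]

theorem exists_extension_zeroCompletion (f : BlueprintHom R S) (hS : IsProper S)
    (h0 : HasZeroElem S) :
    ∃ g : BlueprintHom (submonoidRel (zeroCompletion R)) S,
      ∀ a, g.toMonoidHom ((toZeroCompletion R).toMonoidHom a) = f.toMonoidHom a := by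
  have hex : ∀ q : zeroCompletion R, ∃ b, toQuotient S b = f.quotientMap q := by
    rintro ⟨_, rfl | ⟨a, rfl⟩⟩
    · obtain ⟨e, he⟩ := h0
      refine ⟨e, ?_⟩
      rw [map_zero, toQuotient_apply, (mkQuotient_eq_iff S).2 he, map_zero]
    · exact ⟨_, (f.quotientMap_toQuotient a).symm⟩
  choose g hg using hex
  have inj := toQuotient_injective hS
  let g' : zeroCompletion R →* B :=
    { toFun := g
      map_one' := inj (by simp [hg])
      map_mul' := fun x y ↦ inj (by simp [hg]) }
  refine ⟨ofSubmonoid f.quotientMap g' hg, fun a ↦ inj ?_⟩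
  exact (hg _).trans (f.quotientMap_toQuotient a)

theorem zeroCompletion_rel_zero :
    submonoidRel (zeroCompletion R) (MonoidAlgebra.of ℕ (zeroCompletion R) ⟨0, Or.inl rfl⟩) 0 := by
  rw [submonoidRel_iff, evalSubmonoid_of, map_zero]

theorem eq_of_comp_toZeroCompletion_eq (hS : IsProper S) (h0 : HasZeroElem S)
    {g g' : BlueprintHom (submonoidRel (zeroCompletion R)) S}
    (h : ∀ a, g.toMonoidHom ((toZeroCompletion R).toMonoidHom a) =
      g'.toMonoidHom ((toZeroCompletion R).toMonoidHom a)) : g = g' := by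
  obtain ⟨e, he⟩ := h0
  refine toMonoidHom_injective (MonoidHom.ext ?_)
  rintro ⟨_, rfl | ⟨a, rfl⟩⟩
  · rw [g.toMonoidHom_eq_of_rel_zero hS zeroCompletion_rel_zero he,
      g'.toMonoidHom_eq_of_rel_zero hS zeroCompletion_rel_zero he]
  · exact h a

end BlueprintHom

/-- For every blueprint `B` there is a proper blueprint `B₀` with a zero
together with a morphism `π : B → B₀` such that every morphism from `B` into a proper
blueprint with a zero factors uniquely through `π`. -/
theorem blueprint_exists_zero_completion {A : Type u} [CommMonoid A]
    (R : RingCon (MonoidAlgebra ℕ A)) :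
    ∃ (B0 : Blueprint.{u}) (π : BlueprintHom R B0.R),
      Blueprint.IsProper B0.R ∧ Blueprint.HasZeroElem B0.R ∧
      ∀ (C : Blueprint.{v}), Blueprint.IsProper C.R → Blueprint.HasZeroElem C.R →
        ∀ f : BlueprintHom R C.R,
          ∃! g : BlueprintHom B0.R C.R,
            ∀ a : A, g.toMonoidHom (π.toMonoidHom a) = f.toMonoidHom a := by
  refine ⟨⟨Blueprint.zeroCompletion R, Blueprint.submonoidRel _⟩,
    BlueprintHom.toZeroCompletion R, Blueprint.isProper_submonoidRel _,
    ⟨_, BlueprintHom.zeroCompletion_rel_zero⟩, fun C hC h0 f ↦ ?_⟩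
  obtain ⟨g, hg⟩ := f.exists_extension_zeroCompletion hC h0
  exact ⟨g, hg, fun g' hg' ↦ BlueprintHom.eq_of_comp_toZeroCompletion_eq hC h0
    fun a ↦ (hg' a).trans (hg a).symm⟩
end

section
/- Let f : B₁ → B₂ be a morphism of blueprints. Then the kernel ∼_f of f, defined on A₁ by a ∼_f b if and only if f(a) ≡ f(b) in B₂, is a congruence on B₁. -/
/-! Congruences on a blueprint `B = (A, R)`, where `R` is a pre-addition, i.e. a semiring
congruence (`RingCon`) on the monoid semiring `ℕ[A] = MonoidAlgebra ℕ A`. -/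

/-- `x` and `y` are termwise related sums: `x = Σ aᵢ`, `y = Σ bᵢ` with `r aᵢ bᵢ` for all `i`. -/
def Blueprint.Termwise {A : Type*} [CommMonoid A] (r : A → A → Prop)
    (x y : MonoidAlgebra ℕ A) : Prop :=
  ∃ l : List (A × A), (∀ p ∈ l, r p.1 p.2) ∧
    x = (l.map fun p => MonoidAlgebra.of ℕ A p.1).sum ∧
    y = (l.map fun p => MonoidAlgebra.of ℕ A p.2).sum

/-- The linear extension `∼_ℕ` of a relation `∼` on `A` to `ℕ[A]`: the smallest equivalence
relation such that `Σ aᵢ ∼_ℕ Σ bᵢ` whenever `aᵢ ∼ bᵢ` termwise. -/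
def Blueprint.LinExt {A : Type*} [CommMonoid A] (r : A → A → Prop) :
    MonoidAlgebra ℕ A → MonoidAlgebra ℕ A → Prop :=
  Relation.EqvGen (Blueprint.Termwise r)

/-- `∼_R`: the smallest equivalence relation on `ℕ[A]` containing both `R` and `∼_ℕ`. -/
def Blueprint.SimR {A : Type*} [CommMonoid A] (R : RingCon (MonoidAlgebra ℕ A))
    (r : A → A → Prop) : MonoidAlgebra ℕ A → MonoidAlgebra ℕ A → Prop :=
  Relation.EqvGen (fun x y => R x y ∨ Blueprint.LinExt r x y)

/-- A congruence on the blueprint `(A, R)`: an equivalence relation `∼` on `A` such that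
(C1) `∼_ℕ` is a pre-addition (additive and multiplicative) and (C2) the restriction of
`∼_R` to `A` equals `∼`. -/
structure Blueprint.IsCongruence {A : Type*} [CommMonoid A]
    (R : RingCon (MonoidAlgebra ℕ A)) (r : A → A → Prop) : Prop where
  equiv : Equivalence r
  lin_add : ∀ x x' y y' : MonoidAlgebra ℕ A, Blueprint.LinExt r x x' →
    Blueprint.LinExt r y y' → Blueprint.LinExt r (x + y) (x' + y')
  lin_mul : ∀ x x' y y' : MonoidAlgebra ℕ A, Blueprint.LinExt r x x' →
    Blueprint.LinExt r y y' → Blueprint.LinExt r (x * y) (x' * y')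
  restrict : ∀ a b : A,
    Blueprint.SimR R r (MonoidAlgebra.of ℕ A a) (MonoidAlgebra.of ℕ A b) ↔ r a b

/-- A finite chain `x ≡ Σc₁ ∼_ℕ Σd₁ ≡ Σc₂ ∼_ℕ ⋯ ∼_ℕ Σdₙ ≡ y` alternating between the
pre-addition `R` and the linear extension `∼_ℕ` of `∼`. -/
def Blueprint.ChainRel {A : Type*} [CommMonoid A] (R : RingCon (MonoidAlgebra ℕ A))
    (r : A → A → Prop) (x y : MonoidAlgebra ℕ A) : Prop :=
  ∃ z : MonoidAlgebra ℕ A, R x z ∧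
    Relation.ReflTransGen (fun u v => ∃ w, Blueprint.LinExt r u w ∧ R w v) z y

namespace Blueprint

theorem eqvGen_map₂ {M : Type*} {t : M → M → Prop} (op : M → M → M) (ht : ∀ x, t x x)
    (hop : ∀ x x' y y', t x x' → t y y' → t (op x y) (op x' y')) {x x' y y' : M}
    (hx : Relation.EqvGen t x x') (hy : Relation.EqvGen t y y') :
    Relation.EqvGen t (op x y) (op x' y') := by
  have hleft : Relation.EqvGen t (op x y) (op x' y) := by
    induction hx with
    | rel u v h => exact .rel _ _ (hop _ _ _ _ h (ht y))
    | refl u => exact .refl _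
    | symm u v _ ih => exact ih.symm
    | trans u v w _ _ ih₁ ih₂ => exact ih₁.trans _ _ _ ih₂
  have hright : Relation.EqvGen t (op x' y) (op x' y') := by
    clear hleft
    induction hy with
    | rel u v h => exact .rel _ _ (hop _ _ _ _ (ht x') h)
    | refl u => exact .refl _
    | symm u v _ ih => exact ih.symm
    | trans u v w _ _ ih₁ ih₂ => exact ih₁.trans _ _ _ ih₂
  exact hleft.trans _ _ _ hright

section LinearExtension

variable {A : Type*} [CommMonoid A] {r : A → A → Prop} {x x' y y' : MonoidAlgebra ℕ A}

theorem Termwise.zero : Termwise r 0 0 := ⟨[], by simp⟩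

theorem Termwise.of {a b : A} (h : r a b) :
    Termwise r (MonoidAlgebra.of ℕ A a) (MonoidAlgebra.of ℕ A b) :=
  ⟨[(a, b)], by simpa using h⟩

theorem Termwise.add (hx : Termwise r x x') (hy : Termwise r y y') :
    Termwise r (x + y) (x' + y') := by
  obtain ⟨l, hl, rfl, rfl⟩ := hx
  obtain ⟨m, hm, rfl, rfl⟩ := hy
  refine ⟨l ++ m, fun p hp => ?_, by simp, by simp⟩
  exact (List.mem_append.mp hp).elim (hl p) (hm p)

/-- Induction principle: termwise related sums are built from `0` by adding related terms. -/
theorem Termwise.induction_on {P : MonoidAlgebra ℕ A → MonoidAlgebra ℕ A → Prop}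
    (h : Termwise r x x') (zero : P 0 0)
    (of_add : ∀ a b u v, r a b → P u v →
      P (MonoidAlgebra.of ℕ A a + u) (MonoidAlgebra.of ℕ A b + v)) : P x x' := by
  obtain ⟨l, hl, rfl, rfl⟩ := h
  induction l with
  | nil => simpa using zero
  | cons p l ih =>
    simp only [List.map_cons, List.sum_cons]
    exact of_add _ _ _ _ (hl p (by simp)) (ih fun q hq => hl q (by simp [hq]))

theorem Termwise.refl (hr : ∀ a, r a a) (x : MonoidAlgebra ℕ A) : Termwise r x x := by
  induction x using MonoidAlgebra.induction_on with
  | of a => exact .of (hr a)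
  | add u v hu hv => exact hu.add hv
  | smul n u hu =>
    induction n with
    | zero => simpa using Termwise.zero
    | succ n ih => simpa only [succ_nsmul] using ih.add hu

theorem Termwise.mul (hr : ∀ a b c d, r a b → r c d → r (a * c) (b * d))
    (hx : Termwise r x x') (hy : Termwise r y y') : Termwise r (x * y) (x' * y') := by
  refine hx.induction_on (P := fun u v => Termwise r (u * y) (v * y')) ?_ ?_
  · simpa using Termwise.zero
  · intro a b u v hab huv
    rw [add_mul, add_mul]
    refine Termwise.add ?_ huv
    refine hy.induction_on (P := fun u v => Termwise r (MonoidAlgebra.of ℕ A a * u)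
      (MonoidAlgebra.of ℕ A b * v)) ?_ ?_
    · simpa using Termwise.zero
    · intro c d s t hcd hst
      rw [mul_add, mul_add, ← map_mul, ← map_mul]
      exact (Termwise.of (hr _ _ _ _ hab hcd)).add hst

theorem LinExt.add (hr : ∀ a, r a a) (hx : LinExt r x x') (hy : LinExt r y y') :
    LinExt r (x + y) (x' + y') :=
  eqvGen_map₂ (· + ·) (Termwise.refl hr) (fun _ _ _ _ => Termwise.add) hx hy

theorem LinExt.mul (hr : ∀ a, r a a) (hmul : ∀ a b c d, r a b → r c d → r (a * c) (b * d))
    (hx : LinExt r x x') (hy : LinExt r y y') : LinExt r (x * y) (x' * y') :=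
  eqvGen_map₂ (· * ·) (Termwise.refl hr) (fun _ _ _ _ => Termwise.mul hmul) hx hy

end LinearExtension

/-- A relation contained in the kernel of a ring homomorphism modulo a ring congruence has its
linear extension contained there as well. -/
theorem LinExt.map_rel {A M : Type*} [CommMonoid A] [Semiring M] {r : A → A → Prop}
    (S : RingCon M) (F : MonoidAlgebra ℕ A →+* M)
    (hr : ∀ a b, r a b → S (F (MonoidAlgebra.of ℕ A a)) (F (MonoidAlgebra.of ℕ A b)))
    {x y : MonoidAlgebra ℕ A} (h : LinExt r x y) : S (F x) (F y) := by
  induction h with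
  | rel u v h =>
    refine h.induction_on (P := fun u v => S (F u) (F v)) (S.refl _) ?_
    intro a b u v hab huv
    rw [map_add F, map_add F]
    exact S.add (hr a b hab) huv
  | refl u => exact S.refl _
  | symm u v _ ih => exact S.symm ih
  | trans u v w _ _ ih₁ ih₂ => exact S.trans ih₁ ih₂

theorem SimR.map_rel {A M : Type*} [CommMonoid A] [Semiring M] {r : A → A → Prop}
    {R : RingCon (MonoidAlgebra ℕ A)} (S : RingCon M) (F : MonoidAlgebra ℕ A →+* M)
    (hR : ∀ x y, R x y → S (F x) (F y))
    (hr : ∀ a b, r a b → S (F (MonoidAlgebra.of ℕ A a)) (F (MonoidAlgebra.of ℕ A b)))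
    {x y : MonoidAlgebra ℕ A} (h : SimR R r x y) : S (F x) (F y) := by
  induction h with
  | rel u v h => exact h.elim (hR u v) (LinExt.map_rel S F hr)
  | refl u => exact S.refl _
  | symm u v _ ih => exact S.symm ih
  | trans u v w _ _ ih₁ ih₂ => exact S.trans ih₁ ih₂

end Blueprint

/-- The kernel `∼_f` of a morphism of blueprints `f : B₁ → B₂`, defined by
`a ∼_f b` iff `f(a) ≡ f(b)` in `B₂`, is a congruence on `B₁`. -/
theorem blueprint_kernel_isCongruence {A B : Type*} [CommMonoid A] [CommMonoid B]
    (R : RingCon (MonoidAlgebra ℕ A)) (S : RingCon (MonoidAlgebra ℕ B))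
    (f : BlueprintHom R S) :
    Blueprint.IsCongruence R (fun a b =>
      S (MonoidAlgebra.of ℕ B (f.toMonoidHom a)) (MonoidAlgebra.of ℕ B (f.toMonoidHom b))) := by
  have hmul : ∀ a b c d : A,
      S (.of ℕ B (f.toMonoidHom a)) (.of ℕ B (f.toMonoidHom b)) →
      S (.of ℕ B (f.toMonoidHom c)) (.of ℕ B (f.toMonoidHom d)) →
      S (.of ℕ B (f.toMonoidHom (a * c))) (.of ℕ B (f.toMonoidHom (b * d))) := by
    intro a b c d hab hcd
    simp only [map_mul]
    exact S.mul hab hcd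
  have hof : ∀ a : A, MonoidAlgebra.mapDomainRingHom ℕ f.toMonoidHom (MonoidAlgebra.of ℕ A a) =
      MonoidAlgebra.of ℕ B (f.toMonoidHom a) := by
    intro a
    simp
  refine ⟨⟨fun _ => S.refl _, S.symm, S.trans⟩,
    fun _ _ _ _ => Blueprint.LinExt.add fun _ => S.refl _,
    fun _ _ _ _ => Blueprint.LinExt.mul (fun _ => S.refl _) hmul,
    fun a b => ⟨fun h => ?_, fun h => ?_⟩⟩
  · simpa only [hof] using Blueprint.SimR.map_rel S
      (MonoidAlgebra.mapDomainRingHom ℕ f.toMonoidHom) f.map_rel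
      (fun a b hab => by simpa only [hof] using hab) h
  · exact .rel _ _ (.inr (.rel _ _ (.of h)))
end

section
/- Let B = (A, R) be a blueprint and ∼ a congruence on B. Then the absorbing ideal I_∼ = { e ∈ A : e·b ∼ e for all b ∈ A } is an ideal of B. -/
/-- The equivalence relation `∼^I` on `A` associated to a subset `I ⊆ A`:
`a ∼^I b` iff `a = b` or `a, b ∈ I`. -/
def Blueprint.relOfSet {A : Type*} (I : Set A) : A → A → Prop :=
  fun a b => a = b ∨ (a ∈ I ∧ b ∈ I)

/-- The relation `∼_I` on `A`: the restriction to `A` of the smallest equivalence relation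
on `ℕ[A]` containing `R` and the linear extension of `∼^I`. -/
def Blueprint.SimI {A : Type*} [CommMonoid A] (R : RingCon (MonoidAlgebra ℕ A))
    (I : Set A) : A → A → Prop :=
  fun a b => Blueprint.SimR R (Blueprint.relOfSet I)
    (MonoidAlgebra.of ℕ A a) (MonoidAlgebra.of ℕ A b)

/-- An ideal of the blueprint `B = (A, R)`. -/
structure Blueprint.IsIdeal {A : Type*} [CommMonoid A]
    (R : RingCon (MonoidAlgebra ℕ A)) (I : Set A) : Prop where
  mul_mem : ∀ a ∈ I, ∀ b : A, a * b ∈ I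
  zero_mem : ∀ e : A, R (MonoidAlgebra.of ℕ A e) 0 → e ∈ I
  closed : ∀ a b : A, Blueprint.SimI R I a b → b ∈ I → a ∈ I

namespace Blueprint

variable {A : Type*} [CommMonoid A] {R : RingCon (MonoidAlgebra ℕ A)} {r s : A → A → Prop}

theorem LinExt.of_rel {a b : A} (h : r a b) :
    LinExt r (MonoidAlgebra.of ℕ A a) (MonoidAlgebra.of ℕ A b) :=
  .rel _ _ ⟨[(a, b)], by simpa using h, by simp, by simp⟩

theorem LinExt.mono (h : ∀ a b, r a b → s a b) {x y : MonoidAlgebra ℕ A}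
    (hxy : LinExt r x y) : LinExt s x y :=
  Relation.EqvGen.mono (fun _ _ ⟨l, hl, hx, hy⟩ => ⟨l, fun p hp => h _ _ (hl p hp), hx, hy⟩) _ _ hxy

theorem SimR.mono (h : ∀ a b, r a b → s a b) {x y : MonoidAlgebra ℕ A}
    (hxy : SimR R r x y) : SimR R s x y :=
  Relation.EqvGen.mono (fun _ _ => Or.imp_right (LinExt.mono h)) _ _ hxy

theorem IsCongruence.mul_right (hc : IsCongruence R r) {a b : A} (h : r a b) (c : A) :
    r (a * c) (b * c) := by
  refine (hc.restrict _ _).1 (.rel _ _ (.inr ?_))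
  rw [map_mul, map_mul]
  exact hc.lin_mul _ _ _ _ (.of_rel h) (.of_rel (hc.equiv.refl c))

theorem IsCongruence.rel_of_con (hc : IsCongruence R r) {a b : A}
    (h : R (MonoidAlgebra.of ℕ A a) (MonoidAlgebra.of ℕ A b)) : r a b :=
  (hc.restrict _ _).1 (.rel _ _ (.inl h))

/-- Any two absorbing elements of a congruence are related. -/
theorem IsCongruence.rel_of_absorbing (hc : IsCongruence R r) {a b : A}
    (ha : ∀ c, r (a * c) a) (hb : ∀ c, r (b * c) b) : r a b :=
  hc.equiv.trans (hc.equiv.symm (ha b)) (mul_comm b a ▸ hb a)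

end Blueprint

/-- The absorbing ideal `I_∼ = { e ∈ A : e·b ∼ e for all b ∈ A }` of a
congruence `∼` on the blueprint `B = (A, R)` is an ideal of `B`. -/
theorem blueprint_absorbingIdeal_isIdeal {A : Type*} [CommMonoid A]
    (R : RingCon (MonoidAlgebra ℕ A)) (r : A → A → Prop)
    (hc : Blueprint.IsCongruence R r) :
    Blueprint.IsIdeal R {e : A | ∀ b : A, r (e * b) e} := by
  refine ⟨fun e he b c => ?_, fun e he b => ?_, fun a b hab hb c => ?_⟩
  · rw [mul_assoc]
    exact hc.equiv.trans (he (b * c)) (hc.equiv.symm (he b))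
  · refine hc.rel_of_con (R.trans ?_ (R.symm he))
    simpa only [map_mul, zero_mul] using R.mul he (R.refl (MonoidAlgebra.of ℕ A b))
  · have h : r a b := by
      refine (hc.restrict a b).1 (Blueprint.SimR.mono ?_ hab)
      rintro x y (rfl | ⟨hx, hy⟩)
      · exact hc.equiv.refl x
      · exact hc.rel_of_absorbing hx hy
    exact hc.equiv.trans (hc.mul_right h c) (hc.equiv.trans (hb c) (hc.equiv.symm h))
end
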